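/- Let 0 < p ≤ 1. There exists a constant c_p > 0, depending only on p and λ = sup_k m_k, such that for every martingale f ∈ H_p, ( Σ_{k=1}^∞ M_k^{2−2/p} Σ_{j=1}^{m_k−1} |f̂(j·M_k)|² )^{1/2} ≤ c_p · ‖f‖_{H_p} (Paley-type inequality). -/

import Mathlib

open MeasureTheory Complex Finset
open scoped BigOperators ENNReal NNReal

noncomputable section

instance (n : ℕ) : MeasurableSpace (ZMod n) := ⊤

/-- The Vilenkin group determined by the generating sequence `m`. -/
abbrev Gm (m : ℕ → ℕ) : Type := ∀ _k : ℕ, ZMod (m _k)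

namespace Vilenkin

variable (m : ℕ → ℕ)

/-- The generalized powers `M_0 = 1`, `M_{k+1} = m_k · M_k`. -/
def M : ℕ → ℕ
  | 0 => 1
  | k + 1 => m k * M k

/-- The `j`-th digit `n_j` of `n` in the generalized number system based on `m`. -/
def digit (n j : ℕ) : ℕ := n / M m j % m j

/-- `|n|`, the index of the highest nonzero digit of `n`. -/
def hi (n : ℕ) : ℕ := Nat.findGreatest (fun j => digit m n j ≠ 0) n

/-- `⟨n⟩`, the index of the lowest nonzero digit of `n`. -/
def lo (n : ℕ) : ℕ := sInf {j | digit m n j ≠ 0}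

/-- The generalized Rademacher functions `r_k(x) = exp(2πi x_k / m_k)`. -/
def rad (k : ℕ) (x : Gm m) : ℂ :=
  Complex.exp (2 * Real.pi * Complex.I * ((x k).val : ℂ) / (m k : ℂ))

/-- The Vilenkin functions `ψ_n = ∏_k r_k^{n_k}`. -/
def vil (n : ℕ) (x : Gm m) : ℂ :=
  ∏ k ∈ Finset.range (n + 1), rad m k x ^ digit m n k

/-- The Dirichlet kernels `D_n = ∑_{k=0}^{n-1} ψ_k`. -/
def D (n : ℕ) (x : Gm m) : ℂ := ∑ k ∈ Finset.range n, vil m k x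

/-- The Fejér kernels `K_n = (1/n) ∑_{k=1}^{n} D_k`. -/
def K (n : ℕ) (x : Gm m) : ℂ := (n : ℂ)⁻¹ * ∑ k ∈ Finset.range n, D m (k + 1) x

/-- The Nörlund kernels `F_n = (1/Q_n) ∑_{k=1}^{n} q_{n-k} D_k` where
`Q_n = ∑_{k=0}^{n-1} q_k`. -/
def FK (q : ℕ → ℝ) (n : ℕ) (x : Gm m) : ℂ :=
  ((∑ k ∈ Finset.range n, q k : ℝ) : ℂ)⁻¹ *
    ∑ k ∈ Finset.range n, (q (n - (k + 1)) : ℂ) * D m (k + 1) x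

/-- The cylinder subgroup `I_n = {x : x_0 = … = x_{n-1} = 0}`. -/
def I (n : ℕ) : Set (Gm m) := {x | ∀ k < n, x k = 0}

/-- The cylinder of length `n` around `x`. -/
def cylAt (n : ℕ) (x : Gm m) : Set (Gm m) := {y | ∀ k < n, y k = x k}

/-- `μ` is the normalized Haar measure of `G_m`: the (unique) Borel probability
measure giving each cylinder of length `n` measure `1 / M_n`. -/
def IsHaar (μ : Measure (Gm m)) : Prop :=
  ∀ (n : ℕ) (x : Gm m), μ (cylAt m n x) = (M m n : ℝ≥0∞)⁻¹

/-- A martingale with respect to the filtration `(ℱ_n)` on `G_m`, where `ℱ_n` is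
generated by the first `n` coordinates: each `f n` is integrable and depends only
on the first `n` coordinates, and the conditional expectation of `f N` with
respect to `ℱ_n` (which under the Haar measure is given by averaging over the
cylinders of length `n`) equals `f n` for `n ≤ N`. -/
structure IsMartingale (μ : Measure (Gm m)) (f : ℕ → Gm m → ℂ) : Prop where
  integrable : ∀ n, Integrable (f n) μ
  adapted : ∀ (n : ℕ) (x y : Gm m), (∀ k < n, x k = y k) → f n x = f n y
  mart : ∀ n N : ℕ, n ≤ N → ∀ x : Gm m,
    f n x = (M m n : ℂ) * ∫ t in cylAt m n x, f N t ∂μ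

/-- The Vilenkin–Fourier coefficients of a martingale:
`f̂(i) = lim_k ∫ f^(k) conj(ψ_i) dμ`; for a martingale these integrals are
constant as soon as `M_k > i`, in particular from `k = i + 1` on. -/
def coeff (μ : Measure (Gm m)) (f : ℕ → Gm m → ℂ) (i : ℕ) : ℂ :=
  ∫ x, f (i + 1) x * (starRingEnd ℂ) (vil m i x) ∂μ

/-- The partial sums `S_n f = ∑_{k=0}^{n-1} f̂(k) ψ_k`. -/
def S (μ : Measure (Gm m)) (f : ℕ → Gm m → ℂ) (n : ℕ) (x : Gm m) : ℂ :=
  ∑ k ∈ Finset.range n, coeff m μ f k * vil m k x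

/-- The Fejér means `σ_n f = (1/n) ∑_{k=1}^{n} S_k f`. -/
def sigma (μ : Measure (Gm m)) (f : ℕ → Gm m → ℂ) (n : ℕ) (x : Gm m) : ℂ :=
  (n : ℂ)⁻¹ * ∑ k ∈ Finset.range n, S m μ f (k + 1) x

/-- The Nörlund means `t_n f = (1/Q_n) ∑_{k=1}^{n} q_{n-k} S_k f`. -/
def T (μ : Measure (Gm m)) (q : ℕ → ℝ) (f : ℕ → Gm m → ℂ) (n : ℕ) (x : Gm m) : ℂ :=
  ((∑ k ∈ Finset.range n, q k : ℝ) : ℂ)⁻¹ *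
    ∑ k ∈ Finset.range n, (q (n - (k + 1)) : ℂ) * S m μ f (k + 1) x

/-- The martingale maximal function `f* = sup_n |f^(n)|`. -/
def mstar (f : ℕ → Gm m → ℂ) (x : Gm m) : ℝ≥0∞ := ⨆ n, (‖f n x‖₊ : ℝ≥0∞)

/-- The `L_p`-type quasi-norm `(∫ g^p dμ)^{1/p}` of an `ℝ≥0∞`-valued function. -/
def eLp (μ : Measure (Gm m)) (p : ℝ) (g : Gm m → ℝ≥0∞) : ℝ≥0∞ :=
  (∫⁻ x, g x ^ p ∂μ) ^ (1 / p)

/-- Membership in the martingale Hardy space `H_p`: `‖f‖_{H_p} = ‖f*‖_{L_p} < ∞`. -/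
def MemHp (μ : Measure (Gm m)) (p : ℝ) (f : ℕ → Gm m → ℂ) : Prop :=
  eLp m μ p (mstar m f) ≠ ⊤

/-- The weak-`L_p` quasi-norm `sup_{t>0} t · μ(g > t)^{1/p}`. -/
def wLp (μ : Measure (Gm m)) (p : ℝ) (g : Gm m → ℝ≥0∞) : ℝ≥0∞ :=
  ⨆ t : ℝ≥0, (t : ℝ≥0∞) * μ {x | (t : ℝ≥0∞) < g x} ^ (1 / p)

end Vilenkin


namespace Vilenkin

/-- One step of the pathwise Davis inequality, in terms of norms. -/
lemma davis_step_real {a b d s X Q : ℝ} (ha : 0 ≤ a) (hb : 0 ≤ b) (hd : 0 ≤ d) (hQ : 0 ≤ Q)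
    (haX : a ≤ X) (hs : b ^ 2 = a ^ 2 + 2 * s + d ^ 2) (hdab : d ≤ a + b) (hsad : s ≤ a * d) :
    √(Q + d ^ 2 + max X b ^ 2) / 2 - b ^ 2 / (2 * √(Q + d ^ 2 + max X b ^ 2)) ≤
      √(Q + X ^ 2) / 2 - a ^ 2 / (2 * √(Q + X ^ 2)) - s / √(Q + X ^ 2) + 6 * (max X b - X) := by
  have hX : 0 ≤ X := ha.trans haX
  have hXY : X ≤ max X b := le_max_left _ _
  have hbY : b ≤ max X b := le_max_right _ _
  have hYb : max X b = X ∨ max X b = b := by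
    rcases le_total X b with h | h
    · exact .inr (max_eq_right h)
    · exact .inl (max_eq_left h)
  generalize max X b = Y at *
  have hA2 : √(Q + X ^ 2) ^ 2 = Q + X ^ 2 := Real.sq_sqrt (by positivity)
  have hB2 : √(Q + d ^ 2 + Y ^ 2) ^ 2 = Q + d ^ 2 + Y ^ 2 := Real.sq_sqrt (by positivity)
  have hA0 : 0 ≤ √(Q + X ^ 2) := Real.sqrt_nonneg _
  have hB0 : 0 ≤ √(Q + d ^ 2 + Y ^ 2) := Real.sqrt_nonneg _
  have hAB : √(Q + X ^ 2) ≤ √(Q + d ^ 2 + Y ^ 2) := Real.sqrt_le_sqrt (by nlinarith)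
  generalize √(Q + X ^ 2) = A at *
  generalize √(Q + d ^ 2 + Y ^ 2) = B at *
  have hXA : X ≤ A := by nlinarith
  rcases le_or_gt Y (2 * X) with h | h
  · rcases hA0.eq_or_lt with h0 | hA
    · have hX0 : X = 0 := by linarith
      have ha0 : a = 0 := by linarith
      have hY0 : Y = 0 := by linarith
      have hb0 : b = 0 := by linarith
      have hd0 : d = 0 := by linarith
      have : B = 0 := by
        have : B ^ 2 = 0 := by rw [hB2, hd0, hY0]; subst h0; nlinarith
        simpa using this
      simp [← h0, this, hX0, hY0]
    · have hB : 0 < B := hA.trans_le hAB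
      have e1 : b ^ 2 / (2 * A) - b ^ 2 / (2 * B) ≤ (B - A) / 2 + (Y ^ 2 - X ^ 2) / (2 * A) := by
        rw [div_sub_div _ _ (by positivity) (by positivity),
          div_add_div _ _ (by positivity) (by positivity),
          div_le_div_iff₀ (by positivity) (by positivity)]
        have k1 : b ^ 2 * (B - A) ≤ A * B * (B - A) + (Y ^ 2 - X ^ 2) * B := by
          have : b ^ 2 ≤ Y ^ 2 := by nlinarith
          have k2 : X ^ 2 ≤ A * B := by nlinarith
          nlinarith [mul_nonneg (sub_nonneg.2 hAB) (sub_nonneg.2 this),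
            mul_nonneg (sub_nonneg.2 hAB) (sub_nonneg.2 k2),
            mul_nonneg hA0 (show 0 ≤ Y ^ 2 - X ^ 2 by nlinarith)]
        nlinarith [mul_le_mul_of_nonneg_left k1 hA.le]
      have e2 : (B - A) - (Y ^ 2 - X ^ 2) / (2 * A) ≤ d ^ 2 / (2 * A) := by
        rw [sub_le_iff_le_add, ← add_div, le_div_iff₀ (by positivity)]
        nlinarith [sq_nonneg (B - A)]
      have e3 : (Y ^ 2 - X ^ 2) / (2 * A) ≤ 3 / 2 * (Y - X) := by
        rw [div_le_iff₀ (by positivity)]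
        nlinarith [mul_nonneg (sub_nonneg.2 hXY) (sub_nonneg.2 hXA)]
      have e4 : s / A = b ^ 2 / (2 * A) - a ^ 2 / (2 * A) - d ^ 2 / (2 * A) := by
        have : s = (b ^ 2 - a ^ 2 - d ^ 2) / 2 := by linarith
        rw [this]; field_simp
      linarith
  · have hY : Y = b := by rcases hYb with h' | h' <;> linarith
    have e1 : 0 ≤ b ^ 2 / (2 * B) := by positivity
    have e2 : B ≤ A + d + Y := by
      refine (abs_le_of_sq_le_sq' (a := B) (b := A + d + Y) ?_ (by linarith)).2
      nlinarith [mul_nonneg hA0 hd, mul_nonneg hd (hX.trans hXY), mul_nonneg hA0 (hX.trans hXY)]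
    have e3 : a ^ 2 / (2 * A) ≤ a / 2 := by
      rcases hA0.eq_or_lt with h0 | hA
      · simp [← h0]; linarith
      · rw [div_le_iff₀ (by positivity)]; nlinarith
    have e4 : s / A ≤ d := by
      rcases hA0.eq_or_lt with h0 | hA
      · simp [← h0, hd]
      · rw [div_le_iff₀ (by positivity)]; nlinarith
    linarith

/-- The running maximum of `‖z 0‖, …, ‖z n‖`. -/
def runMax (z : ℕ → ℂ) : ℕ → ℝ
  | 0 => ‖z 0‖
  | n + 1 => max (runMax z n) ‖z (n + 1)‖

/-- The normalisation `√([z]_n + (z*_n)²)` of the pathwise Davis inequality. -/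
def davisNorm (z : ℕ → ℂ) (n : ℕ) : ℝ :=
  √(∑ k ∈ range n, ‖z (k + 1) - z k‖ ^ 2 + runMax z n ^ 2)

lemma norm_le_runMax (z : ℕ → ℂ) (n : ℕ) : ‖z n‖ ≤ runMax z n := by
  cases n with
  | zero => exact le_rfl
  | succ n => exact le_max_right _ _

lemma runMax_nonneg (z : ℕ → ℂ) (n : ℕ) : 0 ≤ runMax z n :=
  (norm_nonneg _).trans (norm_le_runMax z n)

lemma runMax_congr {z w : ℕ → ℂ} {n : ℕ} (h : ∀ k ≤ n, z k = w k) :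
    runMax z n = runMax w n := by
  induction n with
  | zero => simp [runMax, h 0 le_rfl]
  | succ n ih =>
    rw [runMax, runMax, ih fun k hk => h k (hk.trans n.le_succ), h _ le_rfl]

lemma davisNorm_congr {z w : ℕ → ℂ} {n : ℕ} (h : ∀ k ≤ n, z k = w k) :
    davisNorm z n = davisNorm w n := by
  rw [davisNorm, davisNorm, runMax_congr h]
  congr 2
  refine sum_congr rfl fun k hk => ?_
  rw [mem_range] at hk
  rw [h k hk.le, h (k + 1) hk]

lemma davis_step (z : ℕ → ℂ) (n : ℕ) :
    davisNorm z (n + 1) / 2 - ‖z (n + 1)‖ ^ 2 / (2 * davisNorm z (n + 1)) ≤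
      davisNorm z n / 2 - ‖z n‖ ^ 2 / (2 * davisNorm z n)
        - ((starRingEnd ℂ) (z n) * (z (n + 1) - z n)).re / davisNorm z n
        + 6 * (runMax z (n + 1) - runMax z n) := by
  have h := davis_step_real (a := ‖z n‖) (b := ‖z (n + 1)‖) (d := ‖z (n + 1) - z n‖)
    (s := ((starRingEnd ℂ) (z n) * (z (n + 1) - z n)).re) (X := runMax z n)
    (Q := ∑ k ∈ range n, ‖z (k + 1) - z k‖ ^ 2) (norm_nonneg _) (norm_nonneg _) (norm_nonneg _)
    (by positivity) (norm_le_runMax z n)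
    (by
      simp only [← Complex.normSq_eq_norm_sq, Complex.normSq_apply, Complex.mul_re,
        Complex.sub_re, Complex.sub_im, Complex.conj_re, Complex.conj_im]
      ring)
    (by rw [add_comm ‖z n‖]; exact norm_sub_le _ _)
    ((Complex.re_le_norm _).trans (by simp))
  simpa only [davisNorm, runMax, sum_range_succ] using h

/-- Pathwise Davis inequality. -/
lemma sqrt_sum_sq_le (z : ℕ → ℂ) (n : ℕ) :
    √(∑ k ∈ range n, ‖z (k + 1) - z k‖ ^ 2) ≤ 13 * runMax z n
      - 2 * ∑ k ∈ range n, ((starRingEnd ℂ) (z k) * (z (k + 1) - z k)).re / davisNorm z k := by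
  have key : davisNorm z n / 2 - ‖z n‖ ^ 2 / (2 * davisNorm z n) ≤
      6 * (runMax z n)
      - ∑ k ∈ range n, ((starRingEnd ℂ) (z k) * (z (k + 1) - z k)).re / davisNorm z k := by
    induction n with
    | zero =>
      rcases (norm_nonneg (z 0)).eq_or_lt with h | h
      · simp [davisNorm, runMax, ← h]
      · simp only [davisNorm, runMax, range_zero, sum_empty, zero_add, Real.sqrt_sq h.le]
        have : ‖z 0‖ ^ 2 / (2 * ‖z 0‖) = ‖z 0‖ / 2 := by field_simp
        linarith
    | succ n ih =>
      rw [sum_range_succ]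
      linarith [davis_step z n]
  have h1 : √(∑ k ∈ range n, ‖z (k + 1) - z k‖ ^ 2) ≤ davisNorm z n :=
    Real.sqrt_le_sqrt (by nlinarith [sq_nonneg (runMax z n)])
  have h2 : runMax z n ≤ davisNorm z n :=
    Real.le_sqrt_of_sq_le (le_add_of_nonneg_left (by positivity))
  have h3 : ‖z n‖ ^ 2 / (2 * davisNorm z n) ≤ runMax z n / 2 := by
    have hz := norm_le_runMax z n
    have hz0 := norm_nonneg (z n)
    rcases (runMax_nonneg z n).eq_or_lt with h | h
    · have : ‖z n‖ = 0 := by linarith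
      simp [this, ← h]
    · have : 0 < davisNorm z n := h.trans_le h2
      rw [div_le_iff₀ (by positivity)]
      nlinarith
  linarith

/-- Summing `min (v k) (v k)⁻¹` along a sequence growing geometrically. -/
lemma sum_min_inv_le {c : ℝ} (hc : 1 < c) (v : ℕ → ℝ) (hv : ∀ k, 0 < v k)
    (hvc : ∀ k, c * v k ≤ v (k + 1)) (n : ℕ) :
    ∑ k ∈ range n, min (v k) (v k)⁻¹ ≤ 4 * c / (c - 1) := by
  have hc0 : 0 < c - 1 := by linarith
  have hstep : ∀ k, min (v k) (v k)⁻¹ ≤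
      4 * c / (c - 1) * (v (k + 1) / (1 + v (k + 1)) - v k / (1 + v k)) := by
    intro k
    have h0 := hv k
    have h1 : min (v k) (v k)⁻¹ ≤ 4 * v k / (1 + v k) ^ 2 := by
      rw [le_div_iff₀ (by positivity)]
      rcases le_total (v k) 1 with h | h
      · refine (mul_le_mul_of_nonneg_right (min_le_left _ _) (by positivity)).trans ?_
        nlinarith [mul_le_mul_of_nonneg_left (show (1 + v k) ^ 2 ≤ 4 by nlinarith) h0.le]
      · refine (mul_le_mul_of_nonneg_right (min_le_right _ _) (by positivity)).trans ?_
        rw [inv_mul_le_iff₀ h0]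
        nlinarith
    have h2 : c * v k / (1 + c * v k) ≤ v (k + 1) / (1 + v (k + 1)) := by
      rw [div_le_div_iff₀ (by positivity) (by linarith [hv (k + 1)])]
      nlinarith [hvc k]
    refine h1.trans ?_
    have h3 : 4 * v k / (1 + v k) ^ 2 ≤
        4 * c / (c - 1) * (c * v k / (1 + c * v k) - v k / (1 + v k)) := by
      have : 4 * c / (c - 1) * (c * v k / (1 + c * v k) - v k / (1 + v k)) =
          4 * c * v k / ((1 + c * v k) * (1 + v k)) := by
        field_simp
        ring
      rw [this, div_le_div_iff₀ (by positivity) (by positivity)]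
      have : (1 + c * v k) ≤ c * (1 + v k) := by nlinarith
      nlinarith [mul_le_mul_of_nonneg_left this (show 0 ≤ v k * (1 + v k) by positivity)]
    exact h3.trans (by gcongr)
  calc _ ≤ ∑ k ∈ range n, 4 * c / (c - 1) * (v (k + 1) / (1 + v (k + 1)) - v k / (1 + v k)) :=
        sum_le_sum fun k _ => hstep k
    _ = 4 * c / (c - 1) * (v n / (1 + v n) - v 0 / (1 + v 0)) := by
        rw [← mul_sum, sum_range_sub (fun k => v k / (1 + v k))]
    _ ≤ 4 * c / (c - 1) * 1 := by
        gcongr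
        have := hv n
        have := hv 0
        have h1 : v n / (1 + v n) ≤ 1 := by rw [div_le_one (by positivity)]; linarith
        have h2 : 0 ≤ v 0 / (1 + v 0) := by positivity
        linarith
    _ = _ := mul_one _

lemma exists_sum_rpow_mul_le {p : ℝ} (hp0 : 0 < p) (hp1 : p < 1) :
    ∃ C : ℝ, 0 < C ∧ ∀ (N g : ℕ → ℝ) (L t K : ℝ), (∀ k, 0 < N k) → (∀ k, 2 * N k ≤ N (k + 1)) →
      1 ≤ L → 0 < t → 0 < K → (∀ k, g k ≤ t) → (∀ k, g k ≤ L * N k ^ (1 / p) * K) →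
      ∀ n, ∑ k ∈ range n, N k ^ (1 - 1 / p) * g k ≤ L * C * (K ^ (1 - p) * t ^ p) := by
  have hp' : 1 < 1 / p := by rw [lt_div_iff₀ hp0]; linarith
  set β := min 1 (1 / p - 1) with hβ
  have hβ0 : 0 < β := lt_min one_pos (by linarith)
  have hc : 1 < (2 : ℝ) ^ β := Real.one_lt_rpow one_lt_two hβ0
  refine ⟨4 * 2 ^ β / (2 ^ β - 1), div_pos (by positivity) (by linarith), ?_⟩
  intro N g L t K hN hN2 hL ht hK hg1 hg2 n
  set y := (t / K) ^ p with hy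
  have hy0 : 0 < y := by positivity
  have hKy : K ^ (1 - p) * t ^ p = K * y := by
    rw [hy, Real.div_rpow ht.le hK.le, Real.rpow_sub hK, Real.rpow_one]
    ring
  have hv : ∀ k, 0 < (N k / y) ^ β := fun k => Real.rpow_pos_of_pos (div_pos (hN k) hy0) _
  have hsum := sum_min_inv_le hc (fun k => (N k / y) ^ β) hv (fun k => by
    rw [← Real.mul_rpow (by norm_num) (div_pos (hN k) hy0).le]
    refine Real.rpow_le_rpow (mul_pos two_pos (div_pos (hN k) hy0)).le ?_ hβ0.le
    rw [← mul_div_assoc]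
    exact div_le_div_of_nonneg_right (hN2 k) hy0.le) n
  have hmin : ∀ u : ℝ, 0 < u → min u (u ^ (1 - 1 / p)) ≤ min (u ^ β) (u ^ β)⁻¹ := by
    intro u hu
    rw [← Real.rpow_neg hu.le]
    rcases le_total u 1 with h | h
    · refine (min_le_left _ _).trans (le_min ?_ ?_)
      · simpa only [Real.rpow_one] using
          Real.rpow_le_rpow_of_exponent_ge hu h (min_le_left 1 (1 / p - 1))
      · simpa using Real.rpow_le_rpow_of_exponent_ge hu h (show -β ≤ 1 by linarith)
    · refine (min_le_right _ _).trans (le_min ?_ ?_)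
      · exact Real.rpow_le_rpow_of_exponent_le h (by linarith)
      · refine Real.rpow_le_rpow_of_exponent_le h ?_
        linarith [min_le_right 1 (1 / p - 1)]
  have hterm : ∀ k, N k ^ (1 - 1 / p) * g k ≤
      L * (K * y) * min ((N k / y) ^ β) ((N k / y) ^ β)⁻¹ := by
    intro k
    have hu : 0 < N k / y := div_pos (hN k) hy0
    have hpow : 0 < N k ^ (1 - 1 / p) := Real.rpow_pos_of_pos (hN k) _
    refine le_trans ?_ (mul_le_mul_of_nonneg_left (hmin _ hu) (by positivity))
    rw [mul_min_of_nonneg _ _ (by positivity)]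
    refine le_min ?_ ?_
    · refine (mul_le_mul_of_nonneg_left (hg2 k) hpow.le).trans (le_of_eq ?_)
      have : N k ^ (1 - 1 / p) * N k ^ (1 / p) = N k := by
        rw [← Real.rpow_add (hN k)]; simp
      calc _ = L * K * (N k ^ (1 - 1 / p) * N k ^ (1 / p)) := by ring
        _ = _ := by rw [this]; field_simp
    · have : K * y * (N k / y) ^ (1 - 1 / p) = N k ^ (1 - 1 / p) * t := by
        rw [Real.div_rpow (hN k).le hy0.le, Real.rpow_sub hy0, Real.rpow_one, hy,
          ← Real.rpow_mul (by positivity), mul_one_div_cancel hp0.ne', Real.rpow_one]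
        field_simp
      rw [mul_assoc, this]
      have h1 : N k ^ (1 - 1 / p) * g k ≤ N k ^ (1 - 1 / p) * t :=
        mul_le_mul_of_nonneg_left (hg1 k) hpow.le
      have h2 : 0 ≤ N k ^ (1 - 1 / p) * t := by positivity
      nlinarith
  rw [hKy]
  calc _ ≤ ∑ k ∈ range n, L * (K * y) * min ((N k / y) ^ β) ((N k / y) ^ β)⁻¹ :=
        sum_le_sum fun k _ => hterm k
    _ ≤ L * (K * y) * (4 * 2 ^ β / (2 ^ β - 1)) := by
        rw [← mul_sum]; exact mul_le_mul_of_nonneg_left hsum (by positivity)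
    _ = _ := by ring

section Cylinders

instance (n : ℕ) : DiscreteMeasurableSpace (ZMod n) := ⟨fun _ => trivial⟩

variable {m : ℕ → ℕ} {E : Type*}

lemma M_pos (hm : ∀ k, 2 ≤ m k) (k : ℕ) : 0 < M m k := by
  induction k with
  | zero => exact one_pos
  | succ k ih => exact Nat.mul_pos (two_pos.trans_le (hm k)) ih

lemma two_mul_M_le (hm : ∀ k, 2 ≤ m k) (k : ℕ) : 2 * M m k ≤ M m (k + 1) :=
  Nat.mul_le_mul_right _ (hm k)

lemma lt_M (hm : ∀ k, 2 ≤ m k) (k : ℕ) : k < M m k := by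
  induction k with
  | zero => exact one_pos
  | succ k ih => have := two_mul_M_le hm k; omega

lemma M_dvd_M {k l : ℕ} (h : k ≤ l) : M m k ∣ M m l := by
  induction l, h using Nat.le_induction with
  | base => exact dvd_rfl
  | succ l _ ih => exact ih.mul_left _

lemma digit_mul_M (hm : ∀ k, 2 ≤ m k) {j k : ℕ} (hj : j < m k) (l : ℕ) :
    digit m (j * M m k) l = if l = k then j else 0 := by
  unfold digit
  have hM := M_pos hm l
  rcases lt_trichotomy l k with h | rfl | h
  · obtain ⟨c, hc⟩ := M_dvd_M (m := m) (Nat.succ_le_of_lt h)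
    have : j * M m k = M m l * (m l * (j * c)) := by
      rw [hc, Nat.succ_eq_add_one, M]; ring
    rw [this, Nat.mul_div_cancel_left _ hM, Nat.mul_mod_right, if_neg h.ne]
  · rw [Nat.mul_div_cancel _ hM, Nat.mod_eq_of_lt hj, if_pos rfl]
  · have h1 : j * M m k < M m (k + 1) := Nat.mul_lt_mul_of_pos_right hj (M_pos hm k)
    have h2 := Nat.le_of_dvd hM (M_dvd_M (m := m) (Nat.succ_le_of_lt h))
    rw [Nat.div_eq_of_lt (h1.trans_le h2), Nat.zero_mod, if_neg h.ne']

lemma vil_mul_M (hm : ∀ k, 2 ≤ m k) {j k : ℕ} (hj0 : 1 ≤ j) (hj : j < m k) (x : Gm m) :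
    vil m (j * M m k) x = rad m k x ^ j := by
  unfold vil
  rw [prod_eq_single k]
  · rw [digit_mul_M hm hj, if_pos rfl]
  · intro l _ hl
    rw [digit_mul_M hm hj, if_neg hl, pow_zero]
  · intro h
    have := lt_M hm k
    have : M m k ≤ j * M m k := Nat.le_mul_of_pos_left _ hj0
    exact absurd (mem_range.2 (by omega)) h

lemma norm_rad (k : ℕ) (x : Gm m) : ‖rad m k x‖ = 1 := by
  have : 2 * Real.pi * Complex.I * ((x k).val : ℂ) / (m k : ℂ) =
      ((2 * Real.pi * (x k).val / m k : ℝ) : ℂ) * Complex.I := by push_cast; ring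
  rw [rad, this, Complex.norm_exp_ofReal_mul_I]

/-- `F x` depends only on the first `n` coordinates of `x`. -/
def DepOn (n : ℕ) (F : Gm m → E) : Prop := ∀ x y, (∀ k < n, x k = y k) → F x = F y

lemma DepOn.mono {n N : ℕ} {F : Gm m → E} (hF : DepOn n F) (h : n ≤ N) : DepOn N F :=
  fun x y hxy => hF x y fun k hk => hxy k (hk.trans_le h)

/-- The projection to the first `n` coordinates. -/
def proj (n : ℕ) (x : Gm m) : ∀ k : Fin n, ZMod (m k) := fun k => x k

lemma measurable_proj (n : ℕ) : Measurable (proj (m := m) n) :=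
  measurable_pi_lambda _ fun _ => measurable_pi_apply _

lemma cylAt_eq (n : ℕ) (x : Gm m) : cylAt m n x = proj n ⁻¹' {proj n x} := by
  ext y
  simp only [cylAt, Set.mem_ofPred_eq, Set.mem_preimage, Set.mem_singleton_iff, funext_iff, proj]
  exact ⟨fun h k => h k k.2, fun h k hk => h ⟨k, hk⟩⟩

lemma measurableSet_cylAt (n : ℕ) (x : Gm m) : MeasurableSet (cylAt m n x) := by
  rw [cylAt_eq]
  exact measurable_proj n (measurableSet_singleton _)

lemma DepOn.exists_eq_comp {n : ℕ} {F : Gm m → E} (hF : DepOn n F) :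
    ∃ G : (∀ k : Fin n, ZMod (m k)) → E, F = G ∘ proj n :=
  ⟨fun y => F fun k => if h : k < n then y ⟨k, h⟩ else 0,
    funext fun x => hF _ _ fun k hk => by simp [hk, proj]⟩

lemma finite_proj (hm : ∀ k, 2 ≤ m k) (n : ℕ) : Finite (∀ k : Fin n, ZMod (m k)) := by
  have : ∀ k, NeZero (m k) := fun k => ⟨by have := hm k; omega⟩
  infer_instance

lemma DepOn.measurable [MeasurableSpace E] (hm : ∀ k, 2 ≤ m k) {n : ℕ} {F : Gm m → E}
    (hF : DepOn n F) : Measurable F := by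
  have := finite_proj hm n
  obtain ⟨G, rfl⟩ := hF.exists_eq_comp
  exact (measurable_of_countable G).comp (measurable_proj n)

variable {μ : Measure (Gm m)}

lemma IsHaar.isProbabilityMeasure (hμ : IsHaar m μ) : IsProbabilityMeasure μ := by
  refine ⟨?_⟩
  have := hμ 0 0
  simpa [cylAt, M] using this

lemma DepOn.integrable [NormedAddCommGroup E] (hm : ∀ k, 2 ≤ m k) [IsFiniteMeasure μ] {n : ℕ}
    {F : Gm m → E} (hF : DepOn n F) : Integrable F μ := by
  have := finite_proj hm n
  obtain ⟨G, rfl⟩ := hF.exists_eq_comp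
  exact (Integrable.of_finite (μ := μ.map (proj n))).comp_measurable (measurable_proj n)

lemma integral_eq_zero_of_forall_cylAt [NormedAddCommGroup E] [NormedSpace ℝ E]
    (hm : ∀ k, 2 ≤ m k) {n : ℕ} {F : Gm m → E} (hF : Integrable F μ)
    (h : ∀ x, ∫ t in cylAt m n x, F t ∂μ = 0) : ∫ x, F x ∂μ = 0 := by
  have := finite_proj hm n
  have := Fintype.ofFinite (∀ k : Fin n, ZMod (m k))
  have hU : (⋃ y, proj (m := m) n ⁻¹' {y}) = Set.univ := by
    ext x; simp
  rw [← setIntegral_univ, ← hU, integral_iUnion_fintype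
    (fun y => measurable_proj n (measurableSet_singleton y)) _ fun _ => hF.integrableOn]
  · refine sum_eq_zero fun y _ => ?_
    rcases (proj (m := m) n ⁻¹' {y}).eq_empty_or_nonempty with h0 | ⟨x, rfl⟩
    · rw [h0, setIntegral_empty]
    · rw [← cylAt_eq]; exact h x
  · intro y z hyz
    exact Disjoint.preimage _ (Set.disjoint_singleton.2 hyz)

lemma setIntegral_cylAt_mul {n : ℕ} {g : Gm m → ℂ} (hg : DepOn n g) (F : Gm m → ℂ) (x : Gm m) :
    ∫ t in cylAt m n x, g t * F t ∂μ = g x * ∫ t in cylAt m n x, F t ∂μ := by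
  rw [← integral_const_mul]
  exact setIntegral_congr_fun (measurableSet_cylAt n x) fun t ht => by
    simp only [hg t x ht]

lemma IsMartingale.integral_mul_eq {f : ℕ → Gm m → ℂ} (hf : IsMartingale m μ f)
    (hm : ∀ k, 2 ≤ m k) [IsFiniteMeasure μ] {n N : ℕ} (hnN : n ≤ N) {g : Gm m → ℂ}
    (hg : DepOn n g) : ∫ x, g x * f N x ∂μ = ∫ x, g x * f n x ∂μ := by
  have hi : ∀ l, n ≤ l → Integrable (fun x => g x * f l x) μ := fun l hl =>
    DepOn.integrable hm (n := l) fun x y h => by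
      simp only [hg.mono hl x y h, hf.adapted l x y h]
  rw [← sub_eq_zero, ← integral_sub (hi N hnN) (hi n le_rfl)]
  refine integral_eq_zero_of_forall_cylAt hm ((hi N hnN).sub (hi n le_rfl)) (n := n) fun x => ?_
  rw [integral_sub (hi N hnN).integrableOn (hi n le_rfl).integrableOn,
    setIntegral_cylAt_mul hg, setIntegral_cylAt_mul hg, ← mul_sub]
  have h := (hf.mart n N hnN x).symm.trans (hf.mart n n le_rfl x)
  have hM : (M m n : ℂ) ≠ 0 := Nat.cast_ne_zero.2 (M_pos hm n).ne'
  rw [mul_left_cancel₀ hM h, sub_self, mul_zero]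

lemma depOn_rad_pow (k j : ℕ) : DepOn (k + 1) fun x : Gm m => rad m k x ^ j := fun x y h => by
  simp only [rad, h k k.lt_succ_self]

lemma depOn_conj_rad_pow (k j : ℕ) :
    DepOn (k + 1) fun x : Gm m => (starRingEnd ℂ) (rad m k x ^ j) := fun x y h => by
  simp only [depOn_rad_pow k j x y h]

lemma sum_exp_pow_eq_zero {n j : ℕ} [NeZero n] (hj0 : 1 ≤ j) (hj : j < n) :
    ∑ c : ZMod n, Complex.exp (2 * Real.pi * Complex.I * (c.val : ℂ) / (n : ℂ)) ^ j = 0 := by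
  have h := AddChar.sum_mulShift (j : ZMod n) (ZMod.isPrimitive_stdAddChar n)
  have hj' : (j : ZMod n) ≠ 0 := fun h0 =>
    (Nat.le_of_dvd hj0 ((ZMod.natCast_eq_zero_iff j n).1 h0)).not_gt hj
  rw [if_neg hj', Nat.cast_zero] at h
  rw [← h]
  refine sum_congr rfl fun c _ => ?_
  rw [← ZMod.toCircle_apply, ← ZMod.stdAddChar_apply, ← AddChar.map_nsmul_eq_pow, nsmul_eq_mul,
    mul_comm]

lemma setIntegral_cylAt_rad_pow (hμ : IsHaar m μ) (hm : ∀ k, 2 ≤ m k) {k j : ℕ} (hj0 : 1 ≤ j)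
    (hj : j < m k) (x : Gm m) : ∫ t in cylAt m k x, rad m k t ^ j ∂μ = 0 := by
  have := hμ.isProbabilityMeasure
  have : NeZero (m k) := ⟨by have := hm k; omega⟩
  have hmem : ∀ c t, t ∈ cylAt m (k + 1) (Function.update x k c) ↔ t ∈ cylAt m k x ∧ t k = c := by
    intro c t
    simp only [cylAt, Set.mem_ofPred_eq, Nat.lt_succ_iff_lt_or_eq]
    constructor
    · intro h
      refine ⟨fun l hl => ?_, ?_⟩
      · rw [h l (.inl hl), Function.update_of_ne hl.ne]
      · rw [h k (.inr rfl), Function.update_self]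
    · rintro ⟨h, rfl⟩ l (hl | rfl)
      · rw [h l hl, Function.update_of_ne hl.ne]
      · rw [Function.update_self]
  have hU : cylAt m k x = ⋃ c, cylAt m (k + 1) (Function.update x k c) := by
    ext t
    simp only [Set.mem_iUnion, hmem]
    simp
  rw [hU, integral_iUnion_fintype (fun c => measurableSet_cylAt _ _) _
    fun c => (DepOn.integrable hm (depOn_rad_pow k j)).integrableOn]
  · have hc : ∀ c, ∫ t in cylAt m (k + 1) (Function.update x k c), rad m k t ^ j ∂μ =
        ((M m (k + 1) : ℝ)⁻¹ : ℂ) *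
          Complex.exp (2 * Real.pi * Complex.I * (c.val : ℂ) / (m k : ℂ)) ^ j := by
      intro c
      rw [setIntegral_congr_fun (g := fun _ =>
        Complex.exp (2 * Real.pi * Complex.I * (c.val : ℂ) / (m k : ℂ)) ^ j)
        (measurableSet_cylAt _ _) fun t ht => by simp only [rad, ((hmem c t).1 ht).2],
        setIntegral_const, measureReal_def, hμ]
      simp
    simp only [hc]
    rw [← mul_sum, sum_exp_pow_eq_zero hj0 hj, mul_zero]
  · intro c d hcd
    refine Set.disjoint_left.2 fun t hc hd => hcd ?_
    rw [← ((hmem c t).1 hc).2, ((hmem d t).1 hd).2]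

lemma integral_mul_conj_rad_pow (hμ : IsHaar m μ) (hm : ∀ k, 2 ≤ m k) {k j : ℕ} (hj0 : 1 ≤ j)
    (hj : j < m k) {g : Gm m → ℂ} (hg : DepOn k g) :
    ∫ x, g x * (starRingEnd ℂ) (rad m k x ^ j) ∂μ = 0 := by
  have := hμ.isProbabilityMeasure
  refine integral_eq_zero_of_forall_cylAt hm (n := k)
    (DepOn.integrable hm (n := k + 1) fun x y h => ?_) fun x => ?_
  · simp only [hg.mono k.le_succ x y h, depOn_rad_pow k j x y h]
  · rw [setIntegral_cylAt_mul hg, integral_conj, setIntegral_cylAt_rad_pow hμ hm hj0 hj, map_zero,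
      mul_zero]

end Cylinders

section Coefficients

variable {m : ℕ → ℕ} {μ : Measure (Gm m)} {f : ℕ → Gm m → ℂ}

lemma IsMartingale.coeff_eq (hf : IsMartingale m μ f) (hμ : IsHaar m μ) (hm : ∀ k, 2 ≤ m k)
    {k j : ℕ} (hj0 : 1 ≤ j) (hj : j < m k) :
    coeff m μ f (j * M m k) = ∫ x, f (k + 1) x * (starRingEnd ℂ) (rad m k x ^ j) ∂μ := by
  have := hμ.isProbabilityMeasure
  have h1 : k + 1 ≤ j * M m k + 1 := by
    have := lt_M hm k
    have : M m k ≤ j * M m k := Nat.le_mul_of_pos_left _ hj0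
    omega
  simp only [coeff, vil_mul_M hm hj0 hj, mul_comm (f _ _)]
  exact hf.integral_mul_eq hm h1 (depOn_conj_rad_pow k j)

lemma IsMartingale.norm_coeff_le (hf : IsMartingale m μ f) (hμ : IsHaar m μ)
    (hm : ∀ k, 2 ≤ m k) {k j : ℕ} (hj0 : 1 ≤ j) (hj : j < m k) :
    ‖coeff m μ f (j * M m k)‖ ≤ ∫ x, ‖f (k + 1) x‖ ∂μ := by
  rw [hf.coeff_eq hμ hm hj0 hj]
  refine (norm_integral_le_integral_norm _).trans (le_of_eq ?_)
  simp [norm_rad]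

lemma IsMartingale.norm_coeff_le_sub (hf : IsMartingale m μ f) (hμ : IsHaar m μ)
    (hm : ∀ k, 2 ≤ m k) {k j : ℕ} (hj0 : 1 ≤ j) (hj : j < m k) :
    ‖coeff m μ f (j * M m k)‖ ≤ ∫ x, ‖f (k + 1) x - f k x‖ ∂μ := by
  have := hμ.isProbabilityMeasure
  have hi : ∀ l ≤ k + 1, Integrable (fun x => f l x * (starRingEnd ℂ) (rad m k x ^ j)) μ :=
    fun l hl => DepOn.integrable hm (n := k + 1) fun x y h => by
      simp only [depOn_rad_pow k j x y h, hf.adapted l x y fun i hi => h i (hi.trans_le hl)]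
  have : coeff m μ f (j * M m k) =
      ∫ x, (f (k + 1) x - f k x) * (starRingEnd ℂ) (rad m k x ^ j) ∂μ := by
    simp only [sub_mul]
    rw [integral_sub (hi _ le_rfl) (hi _ k.le_succ),
      integral_mul_conj_rad_pow hμ hm hj0 hj (hf.adapted k), sub_zero, hf.coeff_eq hμ hm hj0 hj]
  rw [this]
  refine (norm_integral_le_integral_norm _).trans (le_of_eq ?_)
  simp [norm_rad]

end Coefficients

section Davis

variable {m : ℕ → ℕ} {μ : Measure (Gm m)} {f : ℕ → Gm m → ℂ}

lemma IsMartingale.depOn_runMax (hf : IsMartingale m μ f) (n : ℕ) :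
    DepOn n fun x => runMax (fun k => f k x) n := fun x y h =>
  runMax_congr fun k hk => hf.adapted k x y fun i hi => h i (hi.trans_le hk)

lemma IsMartingale.depOn_davisNorm (hf : IsMartingale m μ f) (n : ℕ) :
    DepOn n fun x => davisNorm (fun k => f k x) n := fun x y h =>
  davisNorm_congr fun k hk => hf.adapted k x y fun i hi => h i (hi.trans_le hk)

lemma IsMartingale.depOn_sub (hf : IsMartingale m μ f) (n : ℕ) :
    DepOn (n + 1) fun x => f (n + 1) x - f n x := fun x y h => by
  simp only [hf.adapted (n + 1) x y h, hf.adapted n x y fun i hi => h i (hi.trans n.lt_succ_self)]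

lemma IsMartingale.depOn_sqrt_sum_sq (hf : IsMartingale m μ f) (n : ℕ) :
    DepOn n fun x => √(∑ k ∈ range n, ‖f (k + 1) x - f k x‖ ^ 2) := fun x y h => by
  refine congrArg Real.sqrt (sum_congr rfl fun k hk => ?_)
  have : f (k + 1) x - f k x = f (k + 1) y - f k y :=
    (hf.depOn_sub k).mono (Nat.succ_le_of_lt (mem_range.1 hk)) x y h
  rw [this]

/-- Davis' inequality: the square function is controlled in `L₁` by the maximal function. -/
lemma IsMartingale.integral_sqrt_sum_sq_le (hf : IsMartingale m μ f) [IsFiniteMeasure μ]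
    (hm : ∀ k, 2 ≤ m k) (n : ℕ) :
    ∫ x, √(∑ k ∈ range n, ‖f (k + 1) x - f k x‖ ^ 2) ∂μ ≤
      13 * ∫ x, runMax (fun k => f k x) n ∂μ := by
  set g : ℕ → Gm m → ℂ := fun k x => (starRingEnd ℂ) (f k x) / davisNorm (fun k => f k x) k with hgdef
  have hg : ∀ k, DepOn k (g k) := fun k x y h => by
    simp only [hgdef, hf.adapted k x y h, hf.depOn_davisNorm k x y h]
  have hgd : ∀ k, DepOn (k + 1) fun x => g k x * (f (k + 1) x - f k x) := fun k x y h => by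
    simp only [(hg k).mono k.le_succ x y h, hf.depOn_sub k x y h]
  have hint : ∀ k, ∫ x, g k x * (f (k + 1) x - f k x) ∂μ = 0 := fun k => by
    simp only [mul_sub]
    rw [integral_sub, hf.integral_mul_eq hm k.le_succ (hg k), sub_self]
    · exact DepOn.integrable hm (n := k + 1) fun x y h => by
        simp only [(hg k).mono k.le_succ x y h, hf.adapted (k + 1) x y h]
    · exact DepOn.integrable hm (n := k) fun x y h => by
        simp only [hg k x y h, hf.adapted k x y h]
  have hint' : ∀ k, ∫ x, (g k x * (f (k + 1) x - f k x)).re ∂μ = 0 := fun k => by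
    have := integral_re (𝕜 := ℂ) (DepOn.integrable (μ := μ) hm (hgd k))
    rw [hint k] at this
    simpa using this
  have hre : ∀ k, Integrable (fun x => (g k x * (f (k + 1) x - f k x)).re) μ := fun k =>
    (DepOn.integrable (μ := μ) hm (hgd k)).re
  have hX : Integrable (fun x => runMax (fun k => f k x) n) μ :=
    DepOn.integrable hm (hf.depOn_runMax n)
  have hpt : ∀ x, √(∑ k ∈ range n, ‖f (k + 1) x - f k x‖ ^ 2) ≤ 13 * runMax (fun k => f k x) n -
      2 * ∑ k ∈ range n, (g k x * (f (k + 1) x - f k x)).re := fun x => by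
    refine (sqrt_sum_sq_le (fun k => f k x) n).trans (le_of_eq ?_)
    congr 2
    refine sum_congr rfl fun k _ => ?_
    rw [hgdef, div_mul_eq_mul_div, Complex.div_ofReal_re]
  calc _ ≤ ∫ x, (13 * runMax (fun k => f k x) n -
        2 * ∑ k ∈ range n, (g k x * (f (k + 1) x - f k x)).re) ∂μ :=
        integral_mono (DepOn.integrable hm (hf.depOn_sqrt_sum_sq n))
          ((hX.const_mul _).sub ((integrable_finsetSum _ fun k _ => hre k).const_mul _)) hpt
    _ = 13 * ∫ x, runMax (fun k => f k x) n ∂μ := by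
        rw [integral_sub (hX.const_mul _) ((integrable_finsetSum _ fun k _ => hre k).const_mul _),
          integral_const_mul, integral_const_mul, integral_finsetSum _ fun k _ => hre k]
        simp only [hint', sum_const_zero, mul_zero, sub_zero]

/-- Minkowski's integral inequality for the `ℓ²`-norm of finitely many functions. -/
lemma sum_sq_integral_le {α : Type*} [MeasurableSpace α] {ν : Measure α} {d : ℕ → α → ℝ} (n : ℕ)
    (hd : ∀ k, Integrable (d k) ν)
    (hs : Integrable (fun x => √(∑ k ∈ range n, d k x ^ 2)) ν) :
    ∑ k ∈ range n, (∫ x, d k x ∂ν) ^ 2 ≤ (∫ x, √(∑ k ∈ range n, d k x ^ 2) ∂ν) ^ 2 := by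
  set a : ℕ → ℝ := fun k => ∫ x, d k x ∂ν
  set R := √(∑ k ∈ range n, a k ^ 2) with hR
  have hR2 : R ^ 2 = ∑ k ∈ range n, a k ^ 2 := Real.sq_sqrt (by positivity)
  have h0 : 0 ≤ ∫ x, √(∑ k ∈ range n, d k x ^ 2) ∂ν :=
    integral_nonneg fun x => Real.sqrt_nonneg _
  have h1 : R ^ 2 ≤ R * ∫ x, √(∑ k ∈ range n, d k x ^ 2) ∂ν := by
    calc R ^ 2 = ∑ k ∈ range n, ∫ x, a k * d k x ∂ν := by
          rw [hR2]
          refine sum_congr rfl fun k _ => ?_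
          rw [integral_const_mul, sq]
      _ = ∫ x, ∑ k ∈ range n, a k * d k x ∂ν :=
          (integral_finsetSum _ fun k _ => (hd k).const_mul _).symm
      _ ≤ ∫ x, R * √(∑ k ∈ range n, d k x ^ 2) ∂ν :=
          integral_mono (integrable_finsetSum _ fun k _ => (hd k).const_mul _) (hs.const_mul _)
            fun x => Real.sum_mul_le_sqrt_mul_sqrt _ _ _
      _ = _ := integral_const_mul _ _
  rw [← hR2]
  have hR0 : 0 ≤ R := Real.sqrt_nonneg _
  rcases hR0.eq_or_lt with h | h
  · rw [← h, zero_pow two_ne_zero]; exact sq_nonneg _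
  · exact pow_le_pow_left₀ hR0 (le_of_mul_le_mul_left (by rwa [← sq]) h) 2

lemma ofReal_runMax_le_mstar (f : ℕ → Gm m → ℂ) (x : Gm m) (n : ℕ) :
    ENNReal.ofReal (runMax (fun k => f k x) n) ≤ mstar m f x := by
  have h : ∀ k, ENNReal.ofReal ‖f k x‖ ≤ mstar m f x := fun k => by
    rw [ofReal_norm]; exact le_iSup (fun n => (‖f n x‖₊ : ℝ≥0∞)) k
  induction n with
  | zero => exact h 0
  | succ n ih =>
    rcases max_choice (runMax (fun k => f k x) n) ‖f (n + 1) x‖ with h' | h' <;> rw [runMax, h']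
    exacts [ih, h _]

lemma IsMartingale.tsum_sq_integral_le (hf : IsMartingale m μ f) [IsFiniteMeasure μ]
    (hm : ∀ k, 2 ≤ m k) :
    ∑' k, ENNReal.ofReal (∫ x, ‖f (k + 1) x - f k x‖ ∂μ) ^ 2 ≤
      (13 * ∫⁻ x, mstar m f x ∂μ) ^ 2 := by
  refine ENNReal.tsum_le_of_sum_range_le fun n => ?_
  have hi : ∀ k, Integrable (fun x => ‖f (k + 1) x - f k x‖) μ := fun k =>
    (DepOn.integrable hm (hf.depOn_sub k)).norm
  have h1 := (sum_sq_integral_le n hi (DepOn.integrable hm (hf.depOn_sqrt_sum_sq n))).trans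
    (pow_le_pow_left₀ (integral_nonneg fun x => Real.sqrt_nonneg _)
      (hf.integral_sqrt_sum_sq_le hm n) 2)
  have hX : Integrable (fun x => runMax (fun k => f k x) n) μ :=
    DepOn.integrable hm (hf.depOn_runMax n)
  have hnn : ∀ k, 0 ≤ ∫ x, ‖f (k + 1) x - f k x‖ ∂μ := fun k =>
    integral_nonneg fun x => norm_nonneg _
  have hX0 : 0 ≤ ∫ x, runMax (fun k => f k x) n ∂μ := integral_nonneg fun x => runMax_nonneg _ _
  calc _ = ENNReal.ofReal (∑ k ∈ range n, (∫ x, ‖f (k + 1) x - f k x‖ ∂μ) ^ 2) := by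
        rw [ENNReal.ofReal_sum_of_nonneg fun k _ => sq_nonneg _]
        exact sum_congr rfl fun k _ => (ENNReal.ofReal_pow (hnn k) 2).symm
    _ ≤ ENNReal.ofReal ((13 * ∫ x, runMax (fun k => f k x) n ∂μ) ^ 2) := ENNReal.ofReal_le_ofReal h1
    _ = (13 * ENNReal.ofReal (∫ x, runMax (fun k => f k x) n ∂μ)) ^ 2 := by
        rw [ENNReal.ofReal_pow (by positivity), ENNReal.ofReal_mul (by norm_num)]
        norm_num
    _ ≤ _ := by
        rw [ofReal_integral_eq_lintegral_ofReal hX (.of_forall fun x => runMax_nonneg _ _)]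
        gcongr with x
        exact ofReal_runMax_le_mstar f x n

end Davis

section Paley

variable {m : ℕ → ℕ} {μ : Measure (Gm m)} {f : ℕ → Gm m → ℂ} {p : ℝ}

lemma eLp_rpow (hp0 : 0 < p) (g : Gm m → ℝ≥0∞) : eLp m μ p g ^ p = ∫⁻ x, g x ^ p ∂μ := by
  rw [eLp, ← ENNReal.rpow_mul, one_div_mul_cancel hp0.ne', ENNReal.rpow_one]

lemma IsMartingale.enorm_le (hf : IsMartingale m μ f) (hμ : IsHaar m μ) (hm : ∀ k, 2 ≤ m k)
    (hp0 : 0 < p) (n : ℕ) (x : Gm m) :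
    ‖f n x‖ₑ ≤ (M m n : ℝ≥0∞) ^ (1 / p) * eLp m μ p (mstar m f) := by
  have hM0 : (M m n : ℝ≥0∞) ≠ 0 := Nat.cast_ne_zero.2 (M_pos hm n).ne'
  have h : ‖f n x‖ₑ ^ p * (M m n : ℝ≥0∞)⁻¹ ≤ ∫⁻ x, mstar m f x ^ p ∂μ := by
    rw [← hμ n x, ← setLIntegral_const]
    refine (setLIntegral_mono' (measurableSet_cylAt n x) fun y hy => ?_).trans
      (setLIntegral_le_lintegral _ _)
    refine ENNReal.rpow_le_rpow ?_ hp0.le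
    rw [← hf.adapted n y x hy]
    exact le_iSup (fun n => (‖f n y‖₊ : ℝ≥0∞)) n
  rw [← div_eq_mul_inv, ENNReal.div_le_iff hM0 (ENNReal.natCast_ne_top _), mul_comm] at h
  rw [eLp, ← ENNReal.mul_rpow_of_nonneg _ _ (by positivity), one_div, ENNReal.le_rpow_inv_iff hp0]
  exact h

/-- A geometric interpolation between the pointwise bounds of a martingale. -/
lemma exists_tsum_integral_le (hp0 : 0 < p) (hp1 : p < 1) :
    ∃ C : ℝ, 0 < C ∧ ∀ (m : ℕ → ℕ) (lam : ℕ), (∀ k, 2 ≤ m k) → (∀ k, m k ≤ lam) →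
      ∀ (μ : Measure (Gm m)), IsHaar m μ → ∀ f, IsMartingale m μ f → MemHp m μ p f →
      ∑' k, (M m k : ℝ≥0∞) ^ (1 - 1 / p) * ENNReal.ofReal (∫ x, ‖f (k + 1) x‖ ∂μ) ≤
        ENNReal.ofReal ((lam : ℝ) ^ (1 / p) * C) * eLp m μ p (mstar m f) := by
  obtain ⟨C, hC, H⟩ := exists_sum_rpow_mul_le hp0 hp1
  refine ⟨C, hC, fun m lam hm hlam μ hμ f hf hfp => ?_⟩
  have := hμ.isProbabilityMeasure
  have hlam1 : (1 : ℝ) ≤ lam := by exact_mod_cast (one_le_two.trans (hm 0)).trans (hlam 0)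
  have hlamp : (1 : ℝ) ≤ (lam : ℝ) ^ (1 / p) := Real.one_le_rpow hlam1 (by positivity)
  set E := eLp m μ p (mstar m f)
  have hEtop : E ≠ ⊤ := hfp
  have hMR : ∀ k, (0 : ℝ) < M m k := fun k => by exact_mod_cast M_pos hm k
  have hle : ∀ n x, ‖f n x‖ₑ ≤ (M m n : ℝ≥0∞) ^ (1 / p) * E := hf.enorm_le hμ hm hp0
  have hstar : ∀ n x, ‖f n x‖ₑ ≤ mstar m f x := fun n x =>
    le_iSup (fun n => (‖f n x‖₊ : ℝ≥0∞)) n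
  set B := ENNReal.ofReal ((lam : ℝ) ^ (1 / p) * C) with hB
  have hB0 : B ≠ 0 := (ENNReal.ofReal_pos.2 (by positivity)).ne'
  have hpt : ∀ x, ∑' k, (M m k : ℝ≥0∞) ^ (1 - 1 / p) * ‖f (k + 1) x‖ₑ ≤
      B * E ^ (1 - p) * mstar m f x ^ p := by
    intro x
    rcases eq_or_ne E 0 with hE0 | hE0
    · have : ∀ n, ‖f n x‖ₑ = 0 := fun n => by simpa [hE0] using hle n x
      simp [this]
    rcases eq_or_ne (mstar m f x) 0 with h0 | h0
    · have : ∀ n, ‖f n x‖ₑ = 0 := fun n => by simpa [h0] using hstar n x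
      simp [this]
    have hEp : E ^ (1 - p) ≠ 0 := by simp [ENNReal.rpow_eq_zero_iff, hE0, hEtop]
    rcases eq_or_ne (mstar m f x) ⊤ with ht | ht
    · rw [ht, ENNReal.top_rpow_of_pos hp0, ENNReal.mul_top (mul_ne_zero hB0 hEp)]
      exact le_top
    have hK : 0 < E.toReal := ENNReal.toReal_pos hE0 hEtop
    have ht' : 0 < (mstar m f x).toReal := ENNReal.toReal_pos h0 ht
    refine ENNReal.tsum_le_of_sum_range_le fun n => ?_
    have hreal := H (fun k => M m k) (fun k => ‖f (k + 1) x‖) ((lam : ℝ) ^ (1 / p))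
      (mstar m f x).toReal E.toReal hMR (fun k => by exact_mod_cast two_mul_M_le hm k) hlamp ht' hK
      (fun k => by
        rw [← toReal_enorm]
        exact ENNReal.toReal_mono ht (hstar (k + 1) x))
      (fun k => by
        rw [← toReal_enorm]
        refine (ENNReal.toReal_mono (ENNReal.mul_ne_top
          (ENNReal.rpow_ne_top_of_nonneg (by positivity) (ENNReal.natCast_ne_top _)) hEtop)
          (hle (k + 1) x)).trans ?_
        rw [ENNReal.toReal_mul, ← ENNReal.toReal_rpow, ENNReal.toReal_natCast,
          ← Real.mul_rpow (by positivity) (by positivity)]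
        gcongr
        exact_mod_cast Nat.mul_le_mul_right _ (hlam k)) n
    calc _ = ENNReal.ofReal (∑ k ∈ range n, (M m k : ℝ) ^ (1 - 1 / p) * ‖f (k + 1) x‖) := by
          rw [ENNReal.ofReal_sum_of_nonneg fun k _ => by positivity]
          refine sum_congr rfl fun k _ => ?_
          rw [ENNReal.ofReal_mul (by positivity), ← ENNReal.ofReal_rpow_of_pos (hMR k),
            ENNReal.ofReal_natCast, ofReal_norm]
      _ ≤ _ := ENNReal.ofReal_le_ofReal hreal
      _ = _ := by
          rw [ENNReal.ofReal_mul (by positivity),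
            ENNReal.ofReal_mul (p := E.toReal ^ (1 - p)) (by positivity), ← ENNReal.ofReal_rpow_of_pos hK, ← ENNReal.ofReal_rpow_of_pos ht',
            ENNReal.ofReal_toReal ht, ENNReal.ofReal_toReal hEtop, mul_assoc]
  have hmeas : ∀ k, Measurable fun x => ‖f (k + 1) x‖ₑ := fun k =>
    (DepOn.measurable hm (hf.adapted (k + 1))).enorm
  have hEp : E ^ (1 - p) ≠ ⊤ := ENNReal.rpow_ne_top_of_nonneg (by linarith) hEtop
  calc _ = ∑' k, ∫⁻ x, (M m k : ℝ≥0∞) ^ (1 - 1 / p) * ‖f (k + 1) x‖ₑ ∂μ := by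
        refine tsum_congr fun k => ?_
        rw [lintegral_const_mul _ (hmeas k), ofReal_integral_norm_eq_lintegral_enorm (hf.integrable _)]
    _ = ∫⁻ x, ∑' k, (M m k : ℝ≥0∞) ^ (1 - 1 / p) * ‖f (k + 1) x‖ₑ ∂μ :=
        (lintegral_tsum fun k => ((hmeas k).const_mul _).aemeasurable).symm
    _ ≤ ∫⁻ x, B * E ^ (1 - p) * mstar m f x ^ p ∂μ := lintegral_mono hpt
    _ = B * (E ^ (1 - p) * E ^ p) := by
        rw [lintegral_const_mul' _ _ (ENNReal.mul_ne_top ENNReal.ofReal_ne_top hEp),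
          ← eLp_rpow hp0, mul_assoc]
    _ = B * E := by
        rw [← ENNReal.rpow_add_of_nonneg _ _ (by linarith) hp0.le, sub_add_cancel,
          ENNReal.rpow_one]

lemma tsum_sq_le_sq_tsum (b : ℕ → ℝ≥0∞) : ∑' k, b k ^ 2 ≤ (∑' k, b k) ^ 2 := by
  rw [sq (∑' k, b k), ← ENNReal.tsum_mul_right]
  gcongr with k
  rw [sq]
  gcongr
  exact ENNReal.le_tsum k

lemma sqrt_tsum_coeff_le (hm : ∀ k, 2 ≤ m k) {lam : ℕ} (hlam : ∀ k, m k ≤ lam)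
    {a : ℕ → ℝ} {B : ℝ≥0∞}
    (ha : ∀ k j, 1 ≤ j → j < m k → ‖coeff m μ f (j * M m k)‖ ≤ a k)
    (hB : ∑' k, ((M m k : ℝ≥0∞) ^ (1 - 1 / p) * ENNReal.ofReal (a k)) ^ 2 ≤ B ^ 2) :
    (∑' k : ℕ, (M m (k + 1) : ℝ≥0∞) ^ (2 - 2 / p) *
      ∑ j ∈ Ico 1 (m (k + 1)), (‖coeff m μ f (j * M m (k + 1))‖₊ : ℝ≥0∞) ^ (2 : ℕ))
        ^ ((1 : ℝ) / 2) ≤ ENNReal.ofReal lam * B := by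
  have hlam1 : (1 : ℝ≥0∞) ≤ lam := by exact_mod_cast (one_le_two.trans (hm 0)).trans (hlam 0)
  have hterm : ∀ k, (M m k : ℝ≥0∞) ^ (2 - 2 / p) *
      ∑ j ∈ Ico 1 (m k), (‖coeff m μ f (j * M m k)‖₊ : ℝ≥0∞) ^ (2 : ℕ) ≤
      lam * ((M m k : ℝ≥0∞) ^ (1 - 1 / p) * ENNReal.ofReal (a k)) ^ 2 := by
    intro k
    have h1 : ∑ j ∈ Ico 1 (m k), (‖coeff m μ f (j * M m k)‖₊ : ℝ≥0∞) ^ (2 : ℕ) ≤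
        lam * ENNReal.ofReal (a k) ^ 2 := by
      refine (sum_le_card_nsmul _ _ (ENNReal.ofReal (a k) ^ 2) fun j hj => ?_).trans ?_
      · rw [mem_Ico] at hj
        gcongr
        rw [← enorm_eq_nnnorm, ← ofReal_norm]
        exact ENNReal.ofReal_le_ofReal (ha k j hj.1 hj.2)
      · rw [nsmul_eq_mul, Nat.card_Ico]
        gcongr
        exact (Nat.sub_le _ _).trans (hlam k)
    have h2 : (M m k : ℝ≥0∞) ^ (2 - 2 / p) = ((M m k : ℝ≥0∞) ^ (1 - 1 / p)) ^ 2 := by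
      rw [← ENNReal.rpow_natCast, ← ENNReal.rpow_mul]
      congr 1
      push_cast
      ring
    rw [h2, mul_pow, mul_left_comm]
    gcongr
  calc _ ≤ (lam * B ^ 2) ^ ((1 : ℝ) / 2) := by
        gcongr
        refine (ENNReal.tsum_le_tsum fun k => hterm (k + 1)).trans ?_
        rw [ENNReal.tsum_mul_left]
        gcongr
        exact (ENNReal.tsum_comp_le_tsum_of_injective (add_left_injective 1) _).trans hB
    _ ≤ ((lam * B) ^ 2) ^ ((1 : ℝ) / 2) := by
        rw [mul_pow]
        gcongr
        exact le_self_pow₀ hlam1 two_ne_zero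
    _ = _ := by
        rw [← ENNReal.rpow_natCast, ← ENNReal.rpow_mul]
        simp

end Paley

end Vilenkin

/-- Paley-type inequality: for `0 < p ≤ 1` there is `c_p > 0`
(depending only on `p` and `λ = sup m_k`) with
`(∑_{k=1}^∞ M_k^{2-2/p} ∑_{j=1}^{m_k-1} |f̂(j M_k)|²)^{1/2} ≤ c_p ‖f‖_{H_p}`
for every martingale `f ∈ H_p`. -/
theorem statement8 (p : ℝ) (hp0 : 0 < p) (hp1 : p ≤ 1) (lam : ℕ) :
    ∃ c : ℝ, 0 < c ∧
      ∀ (m : ℕ → ℕ), (∀ k, 2 ≤ m k) → (∀ k, m k ≤ lam) →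
      ∀ (μ : Measure (Gm m)), Vilenkin.IsHaar m μ →
      ∀ (f : ℕ → Gm m → ℂ), Vilenkin.IsMartingale m μ f → Vilenkin.MemHp m μ p f →
        (∑' k : ℕ, (Vilenkin.M m (k + 1) : ℝ≥0∞) ^ (2 - 2 / p) *
            ∑ j ∈ Finset.Ico 1 (m (k + 1)),
              (‖Vilenkin.coeff m μ f (j * Vilenkin.M m (k + 1))‖₊ : ℝ≥0∞) ^ (2 : ℕ))
            ^ ((1 : ℝ) / 2) ≤
          ENNReal.ofReal c * Vilenkin.eLp m μ p (Vilenkin.mstar m f) := by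
  rcases hp1.lt_or_eq with hp | rfl
  · obtain ⟨C, hC, H⟩ := Vilenkin.exists_tsum_integral_le hp0 hp
    refine ⟨(lam + 1) * ((lam : ℝ) ^ (1 / p) * C) + 1, by positivity, ?_⟩
    intro m hm hlam μ hμ f hf hfp
    refine (Vilenkin.sqrt_tsum_coeff_le hm hlam (fun k j hj0 hj => hf.norm_coeff_le hμ hm hj0 hj)
      ((Vilenkin.tsum_sq_le_sq_tsum _).trans
        (pow_le_pow_left₀ zero_le (H m lam hm hlam μ hμ f hf hfp) 2))).trans ?_
    rw [← mul_assoc, ← ENNReal.ofReal_mul (by positivity)]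
    gcongr
    nlinarith [show 0 ≤ (lam : ℝ) ^ (1 / p) * C by positivity]
  · refine ⟨lam * 13 + 1, by positivity, ?_⟩
    intro m hm hlam μ hμ f hf _
    have := hμ.isProbabilityMeasure
    refine (Vilenkin.sqrt_tsum_coeff_le hm hlam (B := 13 * ∫⁻ x, Vilenkin.mstar m f x ∂μ)
      (fun k j hj0 hj => hf.norm_coeff_le_sub hμ hm hj0 hj)
      (by simpa using hf.tsum_sq_integral_le hm)).trans ?_
    have h13 : (13 : ℝ≥0∞) = ENNReal.ofReal 13 := by norm_num
    simp only [Vilenkin.eLp, ENNReal.rpow_one, div_one]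
    rw [h13, ← mul_assoc, ← ENNReal.ofReal_mul (by positivity)]
    gcongr
    linarith
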